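/- For N ≥ s ≥ 1, the sum over all k-Dyck paths of length (k+1)N of the number of down-steps strictly between the s-th up-step and the (s+1)-st up-step (where down-steps after the N-th up-step count when s = N) equals Σ_{i=1}^{s} (1/(ki+1))·binomial((k+1)i, i) · (k/(N−i+1))·binomial((k+1)(N−i), N−i). -/

import Mathlib

open Finset

def stepVal (k : ℕ) (b : Bool) : ℤ := if b then (k : ℤ) else -1

def pathHeight (k n : ℕ) (f : Fin n → Bool) (j : ℕ) : ℤ :=
  ∑ i ∈ Finset.range j, if h : i < n then stepVal k (f ⟨i, h⟩) else 0

def IsDyckPath (k n : ℕ) (f : Fin n → Bool) : Prop :=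
  (∀ j ≤ n, 0 ≤ pathHeight k n f j) ∧ pathHeight k n f n = 0

instance (k n : ℕ) : DecidablePred (IsDyckPath k n) := fun f => by
  unfold IsDyckPath; infer_instance

def dyckPaths (k n : ℕ) : Finset (Fin n → Bool) :=
  Finset.univ.filter (IsDyckPath k n)

/-- The number of down-steps of `f` occurring before the `s`-th up-step
(i.e. down-steps preceded by fewer than `s` up-steps). -/
def downsBefore (n : ℕ) (f : Fin n → Bool) (s : ℕ) : ℕ :=
  (Finset.univ.filter (fun i : Fin n =>
    f i = false ∧ (Finset.univ.filter (fun j : Fin n => j < i ∧ f j = true)).card < s)).card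

/-- The level at which the `s`-th up-step starts (the `s`-th min-turn level). -/
def minTurn (k n : ℕ) (f : Fin n → Bool) (s : ℕ) : ℚ :=
  (k : ℚ) * ((s : ℚ) - 1) - downsBefore n f s

/-- The level at which the `s`-th up-step ends (the `s`-th max-turn level). -/
def maxTurn (k n : ℕ) (f : Fin n → Bool) (s : ℕ) : ℚ :=
  (k : ℚ) * (s : ℚ) - downsBefore n f s

/-- Paths started at height `h`. -/
def IsD (k : ℕ) (h : ℤ) (n : ℕ) (f : Fin n → Bool) : Prop :=
  (∀ j ≤ n, 0 ≤ h + pathHeight k n f j) ∧ h + pathHeight k n f n = 0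

lemma pathHeight_cons (k n : ℕ) (b : Bool) (f : Fin n → Bool) (j : ℕ) :
    pathHeight k (n+1) (Fin.cons b f) (j+1) = stepVal k b + pathHeight k n f j := by
  unfold pathHeight
  rw [Finset.sum_range_succ', add_comm]
  congr 1
  apply Finset.sum_congr rfl
  intro i _
  by_cases h : i < n
  · have h' : i + 1 < n + 1 := by omega
    rw [dif_pos h, dif_pos h']
    rfl
  · have h' : ¬ (i + 1 < n + 1) := by omega
    rw [dif_neg h, dif_neg h']

lemma isD_nonneg {k : ℕ} {h : ℤ} {n : ℕ} {f : Fin n → Bool} (H : IsD k h n f) : 0 ≤ h := by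
  have := H.1 0 (Nat.zero_le _)
  simpa [pathHeight] using this

lemma isD_cons (k : ℕ) (h : ℤ) (n : ℕ) (b : Bool) (f : Fin n → Bool) :
    IsD k h (n+1) (Fin.cons b f) ↔ 0 ≤ h ∧ IsD k (h + stepVal k b) n f := by
  constructor
  · intro H
    refine ⟨isD_nonneg H, ?_, ?_⟩
    · intro j hj
      have := H.1 (j+1) (by omega)
      rw [pathHeight_cons] at this
      linarith
    · have := H.2
      rw [pathHeight_cons] at this
      linarith
  · rintro ⟨h0, H1, H2⟩
    refine ⟨?_, ?_⟩
    · intro j hj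
      cases j with
      | zero => simpa [pathHeight] using h0
      | succ j =>
        have := H1 j (by omega)
        rw [pathHeight_cons]
        linarith
    · rw [pathHeight_cons]
      linarith

lemma upsBefore_cons (n : ℕ) (b : Bool) (f : Fin n → Bool) (i : Fin n) :
    (Finset.univ.filter (fun j : Fin (n+1) => j < i.succ ∧
      (Fin.cons b f : Fin (n+1) → Bool) j = true)).card =
    (if b then 1 else 0) +
      (Finset.univ.filter (fun j : Fin n => j < i ∧ f j = true)).card := by
  simp only [Finset.card_filter]
  rw [Fin.sum_univ_succ]
  simp [Fin.succ_lt_succ_iff, Fin.succ_pos]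

lemma downsBefore_zero (n : ℕ) (f : Fin n → Bool) : downsBefore n f 0 = 0 := by
  simp [downsBefore]

lemma downsBefore_cons_true (n : ℕ) (f : Fin n → Bool) (s : ℕ) :
    downsBefore (n+1) (Fin.cons true f) (s+1) = downsBefore n f s := by
  unfold downsBefore
  rw [Finset.card_filter, Finset.card_filter, Fin.sum_univ_succ]
  simp only [upsBefore_cons]
  simp [add_comm 1]

lemma downsBefore_cons_false (n : ℕ) (f : Fin n → Bool) (s : ℕ) :
    downsBefore (n+1) (Fin.cons false f) (s+1) = 1 + downsBefore n f (s+1) := by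
  unfold downsBefore
  rw [Finset.card_filter, Finset.card_filter, Fin.sum_univ_succ]
  simp only [upsBefore_cons]
  simp

open Classical in
/-- Weighted sum over paths from height `h`. -/
noncomputable def wsum (k : ℕ) (n : ℕ) (h : ℤ) (w : (Fin n → Bool) → ℚ) : ℚ :=
  ∑ f : Fin n → Bool, if IsD k h n f then w f else 0

open Classical in
lemma wsum_succ (k n : ℕ) (h : ℤ) (h0 : 0 ≤ h) (w : (Fin (n+1) → Bool) → ℚ) :
    wsum k (n+1) h w = wsum k n (h + k) (fun f => w (Fin.cons true f)) +
      wsum k n (h - 1) (fun f => w (Fin.cons false f)) := by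
  unfold wsum
  rw [← (Fin.consEquiv (fun _ : Fin (n+1) => Bool)).sum_comp, Fintype.sum_prod_type,
    Fintype.sum_bool]
  congr 1
  · apply Finset.sum_congr rfl
    intro f _
    have e := isD_cons k h n true f
    simp only [h0, true_and, stepVal, if_true] at e
    exact if_congr e rfl rfl
  · apply Finset.sum_congr rfl
    intro f _
    have e := isD_cons k h n false f
    have e2 : h + stepVal k false = h - 1 := by simp [stepVal, sub_eq_add_neg]
    rw [e2] at e
    simp only [h0, true_and] at e
    exact if_congr e rfl rfl

lemma wsum_neg (k n : ℕ) (h : ℤ) (h0 : h < 0) (w : (Fin n → Bool) → ℚ) :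
    wsum k n h w = 0 := by
  unfold wsum
  apply Finset.sum_eq_zero
  intro f _
  rw [if_neg]
  intro H
  have := isD_nonneg H
  omega

lemma wsum_zero (k : ℕ) (w : (Fin 0 → Bool) → ℚ) :
    wsum k 0 0 w = w default := by
  unfold wsum
  rw [Fintype.sum_unique]
  rw [if_pos]
  · exact congrArg w (Subsingleton.elim _ _)
  · refine ⟨fun j hj => ?_, ?_⟩
    · obtain rfl : j = 0 := by omega
      simp [pathHeight]
    · simp [pathHeight]

lemma wsum_big (k n : ℕ) : ∀ (h : ℤ) (_ : (n : ℤ) < h) (w : (Fin n → Bool) → ℚ),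
    wsum k n h w = 0 := by
  induction n with
  | zero =>
    intro h hh w
    unfold wsum
    apply Finset.sum_eq_zero
    intro f _
    rw [if_neg]
    intro H
    have := H.2
    simp [pathHeight] at this
    simp at hh
    omega
  | succ n ih =>
    intro h hh w
    push_cast at hh
    rw [wsum_succ _ _ _ (by omega), ih _ (by omega), ih _ (by omega), add_zero]

lemma wsum_add (k n : ℕ) (h : ℤ) (w v : (Fin n → Bool) → ℚ) :
    wsum k n h (fun f => w f + v f) = wsum k n h w + wsum k n h v := by
  unfold wsum
  rw [← Finset.sum_add_distrib]
  apply Finset.sum_congr rfl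
  intro f _
  split_ifs <;> simp

/-- Number of paths from height `h` with `m` up-steps. -/
def qq (k : ℕ) : ℕ → ℕ → ℚ
  | 0, _ => 1
  | m+1, h => ∑ g ∈ Finset.range (h+1), qq k m (g + k)

/-- Cumulative oscillation from height `h` with `m` up-steps. -/
def ww (k : ℕ) : ℕ → ℕ → ℕ → ℚ
  | 0, m, h => ∑ g ∈ Finset.range h, qq k m g
  | _+1, 0, _ => 0
  | s+1, m+1, h => ∑ g ∈ Finset.range (h+1), ww k s m (g + k)

lemma count_eq (k : ℕ) : ∀ n m h : ℕ, n = h + (k+1) * m →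
    wsum k n h (fun _ => 1) = qq k m h := by
  intro n
  induction n with
  | zero =>
    intro m h e
    obtain rfl : h = 0 := by omega
    have : m = 0 := by
      rcases Nat.eq_zero_or_pos m with h | h
      · exact h
      · nlinarith
    subst this
    simp [wsum_zero, qq]
  | succ n ih =>
    intro m h e
    rw [wsum_succ _ _ _ (by omega)]
    cases m with
    | zero =>
      rw [wsum_big k n _ (by push_cast; omega)]
      have : (h : ℤ) - 1 = ((h - 1 : ℕ) : ℤ) := by omega
      rw [this, ih 0 (h-1) (by omega)]
      simp [qq]
    | succ m =>
      have e1 : (h : ℤ) + k = ((h + k : ℕ) : ℤ) := by push_cast; rfl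
      rw [e1, ih m (h+k) (by rw [mul_add] at e; omega)]
      cases h with
      | zero =>
        rw [wsum_neg _ _ _ (by simp)]
        simp [qq]
      | succ h =>
        have : ((h + 1 : ℕ) : ℤ) - 1 = (h : ℤ) := by omega
        rw [this, ih (m+1) h (by omega)]
        conv_rhs => rw [qq, Finset.sum_range_succ]
        rw [qq]
        ring

/-- The oscillation. -/
def osc (n s : ℕ) (f : Fin n → Bool) : ℚ :=
  (downsBefore n f (s + 1) : ℚ) - downsBefore n f s

lemma osc_true_zero (n : ℕ) : (fun f : Fin n → Bool => osc (n+1) 0 (Fin.cons true f)) =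
    fun _ => 0 := by
  funext f
  simp [osc, downsBefore_cons_true, downsBefore_zero]

lemma osc_true_succ (n s : ℕ) :
    (fun f : Fin n → Bool => osc (n+1) (s+1) (Fin.cons true f)) = osc n s := by
  funext f
  simp [osc, downsBefore_cons_true]

lemma osc_false_zero (n : ℕ) : (fun f : Fin n → Bool => osc (n+1) 0 (Fin.cons false f)) =
    fun f => 1 + osc n 0 f := by
  funext f
  simp [osc, downsBefore_cons_false, downsBefore_zero]

lemma osc_false_succ (n s : ℕ) :
    (fun f : Fin n → Bool => osc (n+1) (s+1) (Fin.cons false f)) = osc n (s+1) := by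
  funext f
  simp [osc, downsBefore_cons_false]

lemma wsum_const_zero (k n : ℕ) (h : ℤ) : wsum k n h (fun _ => 0) = 0 := by
  simp [wsum]

lemma osc_eq_zero (k : ℕ) : ∀ n m h : ℕ, n = h + (k+1) * m →
    wsum k n h (osc n 0) = ww k 0 m h := by
  intro n
  induction n with
  | zero =>
    intro m h e
    obtain rfl : h = 0 := by omega
    simp [wsum_zero, ww, osc, downsBefore]
  | succ n ih =>
    intro m h e
    rw [wsum_succ _ _ _ (by omega), osc_true_zero, wsum_const_zero, osc_false_zero, zero_add]
    cases h with
    | zero =>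
      rw [wsum_neg _ _ _ (by simp)]
      simp [ww]
    | succ h =>
      have : ((h + 1 : ℕ) : ℤ) - 1 = (h : ℤ) := by omega
      rw [this, wsum_add, ih m h (by omega), count_eq k n m h (by omega)]
      rw [ww, ww, Finset.sum_range_succ]
      ring

lemma osc_eq_succ (k : ℕ) : ∀ n s m h : ℕ, n = h + (k+1) * m →
    wsum k n h (osc n s) = ww k s m h := by
  intro n
  induction n with
  | zero =>
    intro s m h e
    cases s with
    | zero => exact osc_eq_zero k _ _ _ e
    | succ s =>
    obtain rfl : h = 0 := by omega
    have : m = 0 := by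
      rcases Nat.eq_zero_or_pos m with h | h
      · exact h
      · nlinarith
    subst this
    simp [wsum_zero, ww, osc, downsBefore]
  | succ n ih =>
    intro s m h e
    cases s with
    | zero => exact osc_eq_zero k _ _ _ e
    | succ s =>
    rw [wsum_succ _ _ _ (by omega), osc_true_succ, osc_false_succ]
    cases m with
    | zero =>
      rw [wsum_big k n _ (by push_cast; omega)]
      have : (h : ℤ) - 1 = ((h - 1 : ℕ) : ℤ) := by omega
      rw [this, ih (s+1) 0 (h-1) (by omega)]
      simp [ww]
    | succ m =>
      have e1 : (h : ℤ) + k = ((h + k : ℕ) : ℤ) := by push_cast; rfl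
      rw [e1, ih s m (h+k) (by rw [mul_add] at e; omega)]
      cases h with
      | zero =>
        rw [wsum_neg _ _ _ (by simp)]
        simp [ww]
      | succ h =>
        have : ((h + 1 : ℕ) : ℤ) - 1 = (h : ℤ) := by omega
        rw [this, ih (s+1) (m+1) h (by omega)]
        conv_rhs => rw [ww, Finset.sum_range_succ]
        rw [ww]
        ring

lemma ww_diff (k : ℕ) : ∀ s m h : ℕ,
    ww k (s+1) (s+1+m) h - ww k s (s+1+m) h =
      qq k (s+1) h * ∑ g ∈ Finset.range k, qq k m g := by
  intro s
  induction s with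
  | zero =>
    intro m h
    rw [show 0 + 1 + m = m + 1 by ring]
    have key : ∀ g, ww k 0 m (g + k) =
        (∑ i ∈ Finset.range k, qq k m i) + ∑ i ∈ Finset.range g, qq k m (i + k) := by
      intro g
      rw [ww, add_comm g k, Finset.sum_range_add]
      simp [add_comm]
    have h1 : ww k 0 (m+1) h =
        ∑ g ∈ Finset.range (h+1), ∑ i ∈ Finset.range g, qq k m (i + k) := by
      rw [Finset.sum_range_succ', ww]
      simp [qq]
    rw [h1, ww]
    simp only [key, Finset.sum_add_distrib]
    simp [qq]
  | succ s ih =>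
    intro m h
    rw [show s + 1 + 1 + m = (s + 1 + m) + 1 by ring]
    rw [ww, ww, ← Finset.sum_sub_distrib]
    simp only [ih]
    rw [← Finset.sum_mul, qq]

/-- Antidifference of `qq`. -/
def FF (k m j : ℕ) : ℚ :=
  ((j : ℚ) - k) / (m + 1) * (((k+1) * m + j).choose m : ℚ)

lemma choose_rel (A m : ℕ) (h : m ≤ A) :
    (A.choose (m+1) : ℚ) * (m + 1) = A.choose m * ((A : ℚ) - m) := by
  have := Nat.choose_succ_right_eq A m
  have h2 : ((A.choose (m+1) * (m+1) : ℕ) : ℚ) = ((A.choose m * (A - m) : ℕ) : ℚ) := by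
    rw [this]
  push_cast [Nat.cast_sub h] at h2
  exact h2

lemma qq_FF (k : ℕ) : ∀ m g : ℕ, qq k m g = FF k m (g+1) - FF k m g := by
  intro m
  induction m with
  | zero => intro g; simp [qq, FF]
  | succ m ih =>
    intro g
    have h1 : qq k (m+1) g = FF k m (g + 1 + k) := by
      rw [qq]
      simp only [ih]
      have := Finset.sum_range_sub (fun i => FF k m (i + k)) (g+1)
      have e : ∀ i, FF k m (i + k + 1) = FF k m (i + 1 + k) := by
        intro i
        rw [add_right_comm]
      simp only [e]
      rw [this]
      simp [FF]
    rw [h1]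
    unfold FF
    have e1 : (k+1) * m + (g + 1 + k) = (k+1) * (m+1) + g := by ring
    have e2 : (k+1) * (m+1) + (g+1) = ((k+1) * (m+1) + g) + 1 := by ring
    rw [e1, e2, Nat.choose_succ_succ]
    have hr := choose_rel ((k+1)*(m+1)+g) m (by nlinarith)
    generalize hA : (k+1)*(m+1)+g = A at *
    have hA' : (A : ℚ) = (k+1)*(m+1)+g := by rw [← hA]; push_cast; ring
    rw [hA'] at hr
    have hm : (m : ℚ) + 1 ≠ 0 := by positivity
    have hm2 : (m : ℚ) + 1 + 1 ≠ 0 := by positivity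
    push_cast
    field_simp
    linear_combination (-1 : ℚ) * hr

lemma R_eq (k m : ℕ) : ∑ g ∈ Finset.range k, qq k m g =
    (k : ℚ) / (m + 1) * (((k+1) * m).choose m : ℚ) := by
  simp only [qq_FF]
  rw [Finset.sum_range_sub]
  simp [FF]
  ring

lemma C_eq (k m : ℕ) : qq k (m+1) 0 =
    (((k+1) * (m+1)).choose (m+1) : ℚ) / (k * ((m + 1 : ℕ) : ℚ) + 1) := by
  have hr := choose_rel ((k+1)*(m+1)) m (by nlinarith)
  rw [qq]
  simp only [zero_add, Finset.sum_range_one, qq_FF, FF]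
  have e2 : (k+1) * m + (k+1) = (k+1) * (m+1) := by ring
  rw [e2]
  generalize hA : (k+1)*(m+1) = A at *
  have hA' : (A : ℚ) = (k+1)*(m+1) := by rw [← hA]; push_cast; ring
  rw [hA'] at hr
  have hm : (m : ℚ) + 1 ≠ 0 := by positivity
  have hm2 : (k : ℚ) * (m + 1) + 1 ≠ 0 := by positivity
  push_cast
  field_simp
  linear_combination (-1 : ℚ) * hr

/-- The sum, over all `k`-Dyck paths of length `(k+1)N`, of the number of down-steps strictly
between the `s`-th up-step and the `(s+1)`-st up-step (down-steps after the `N`-th up-step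
counting when `s = N`). -/
theorem cumulative_oscillation (k N s : ℕ) (hk : 1 ≤ k) (hs : 1 ≤ s) (hsN : s ≤ N) :
    ∑ f ∈ dyckPaths k ((k + 1) * N),
        ((downsBefore ((k + 1) * N) f (s + 1) : ℚ) - downsBefore ((k + 1) * N) f s) =
      ∑ i ∈ Finset.Icc 1 s,
        ((((k + 1) * i).choose i : ℚ) / (k * i + 1)) *
          ((k : ℚ) / (N - i + 1) * (((k + 1) * (N - i)).choose (N - i) : ℚ)) := by
  have h1 : ∑ f ∈ dyckPaths k ((k + 1) * N),
        ((downsBefore ((k + 1) * N) f (s + 1) : ℚ) - downsBefore ((k + 1) * N) f s) =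
      ww k s N 0 := by
    rw [← osc_eq_succ k ((k+1)*N) s N 0 (by omega), dyckPaths, Finset.sum_filter, wsum]
    apply Finset.sum_congr rfl
    intro f _
    simp [IsDyckPath, IsD, osc]
  rw [h1]
  clear h1 hs
  induction s with
  | zero => simp [ww]
  | succ s ih =>
    rw [Finset.sum_Icc_succ_top (by omega), ← ih (by omega)]
    obtain ⟨m, rfl⟩ := Nat.exists_eq_add_of_le hsN
    have := ww_diff k s m 0
    rw [C_eq, R_eq] at this
    rw [show s + 1 + m - (s + 1) = m by omega]
    rw [show ((s + 1 + m : ℕ) : ℚ) - ((s + 1 : ℕ) : ℚ) + 1 = m + 1 by push_cast; ring]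
    linarith
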